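/- Let A ∈ ℍ^{n×n×n₃} be a third-order quaternion tensor. Then there exist quaternion tensors U, H ∈ ℍ^{n×n×n₃} such that bcirc_z(A) = bcirc_z(U)·bcirc_z(H), where the quaternion matrix bcirc_z(U) is unitary and the quaternion matrix bcirc_z(H) is Hermitian and positive semidefinite. -/

import Mathlib

open Matrix Kronecker

noncomputable section

/-- The real quaternions. -/
abbrev Quat := Quaternion ℝ

/-- The embedding of `ℂ` into the quaternions (via `1` and `i`). -/
def c2q (z : ℂ) : Quat := ⟨z.re, z.im, 0, 0⟩

/-- The quaternion imaginary unit `j`. -/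
def jH : Quat := ⟨0, 0, 1, 0⟩

/-- The first complex component of a quaternion: `q = c2q (qd q) + jH * c2q (qc q)`. -/
def qd (q : Quat) : ℂ := ⟨q.re, q.imI⟩

/-- The second complex component of a quaternion. -/
def qc (q : Quat) : ℂ := ⟨q.imJ, -q.imK⟩

/-- A third-order tensor, given by its family of frontal slices. -/
abbrev Tensor (α : Type*) (n₁ n₂ n₃ : ℕ) := Fin n₃ → Matrix (Fin n₁) (Fin n₂) α

/-- The complex tensor `A_d` in the decomposition `A = A_d + j·A_c`. -/
def Td {n₁ n₂ n₃ : ℕ} (A : Tensor Quat n₁ n₂ n₃) : Tensor ℂ n₁ n₂ n₃ :=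
  fun k i j => qd (A k i j)

/-- The complex tensor `A_c` in the decomposition `A = A_d + j·A_c`. -/
def Tc {n₁ n₂ n₃ : ℕ} (A : Tensor Quat n₁ n₂ n₃) : Tensor ℂ n₁ n₂ n₃ :=
  fun k i j => qc (A k i j)

/-- The normalized `n × n` DFT matrix (0-indexed). -/
def Fmat (n : ℕ) : Matrix (Fin n) (Fin n) ℂ :=
  fun s t => (((Real.sqrt (n : ℝ)) : ℂ))⁻¹ *
    Complex.exp ((-2 * (Real.pi : ℂ) * Complex.I * ((s : ℕ) : ℂ) * ((t : ℕ) : ℂ)) / (n : ℂ))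

/-- The flip permutation matrix `P_n` (0-indexed: `P_{s,t} = 1` iff `s + t ≡ 0 (mod n)`). -/
def Pmat (n : ℕ) : Matrix (Fin n) (Fin n) ℂ :=
  fun s t => if ((s : ℕ) + (t : ℕ)) % n = 0 then 1 else 0

/-- Left scalar multiplication of a quaternion matrix by a quaternion. -/
def lsmul {m n : Type*} (q : Quat) (M : Matrix m n Quat) : Matrix m n Quat :=
  fun i j => q * M i j

/-- Right scalar multiplication of a quaternion matrix by a quaternion. -/
def rsmul {m n : Type*} (q : Quat) (M : Matrix m n Quat) : Matrix m n Quat :=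
  fun i j => M i j * q

/-- The block circulant matrix of a third-order tensor. -/
def bcirc {α : Type*} {n₁ n₂ n₃ : ℕ} (T : Tensor α n₁ n₂ n₃) :
    Matrix (Fin n₃ × Fin n₁) (Fin n₃ × Fin n₂) α :=
  fun p q => T (p.1 - q.1) p.2 q.2

/-- The z-block circulant matrix `bcirc_z(A) = bcirc(A_d) + j·bcirc(A_c)·(P_{n₃} ⊗ I_{n₂})`. -/
def bcircz {n₁ n₂ n₃ : ℕ} (A : Tensor Quat n₁ n₂ n₃) :
    Matrix (Fin n₃ × Fin n₁) (Fin n₃ × Fin n₂) Quat :=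
  (bcirc (Td A)).map c2q +
    lsmul jH ((bcirc (Tc A) * (Pmat n₃ ⊗ₖ (1 : Matrix (Fin n₂) (Fin n₂) ℂ))).map c2q)

/-- `unfold`: stack the frontal slices vertically. -/
def unfoldT {α : Type*} {n₁ n₂ n₃ : ℕ} (T : Tensor α n₁ n₂ n₃) :
    Matrix (Fin n₃ × Fin n₁) (Fin n₂) α :=
  fun p j => T p.1 p.2 j

/-- `fold`: the inverse of `unfold`. -/
def foldT {α : Type*} {n₁ n₂ n₃ : ℕ} (M : Matrix (Fin n₃ × Fin n₁) (Fin n₂) α) :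
    Tensor α n₁ n₂ n₃ :=
  fun k i j => M (k, i) j

/-- The QT-product `A *_Q B = fold(bcirc_z(A)·unfold(B))`. -/
def qtmul {n₁ r n₂ n₃ : ℕ} (A : Tensor Quat n₁ r n₃) (B : Tensor Quat r n₂ n₃) :
    Tensor Quat n₁ n₂ n₃ :=
  foldT (bcircz A * unfoldT B)

/-- The mode-3 quaternion DFT
`Â(i,j,:) = √n₃·F_{n₃}·A_d(i,j,:) + j·√n₃·P_{n₃}·F_{n₃}·A_c(i,j,:)`, tube-wise. -/
def hatT {n₁ n₂ n₃ : ℕ} (A : Tensor Quat n₁ n₂ n₃) : Tensor Quat n₁ n₂ n₃ :=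
  fun k i j =>
    c2q (((Real.sqrt (n₃ : ℝ)) : ℂ) * ∑ t, Fmat n₃ k t * Td A t i j) +
    jH * c2q (((Real.sqrt (n₃ : ℝ)) : ℂ) * ∑ t, (Pmat n₃ * Fmat n₃) k t * Tc A t i j)

/-- `diag(Â)`: the block diagonal matrix with the frontal slices as diagonal blocks. -/
def blkDiag {α : Type*} [Zero α] {n₁ n₂ n₃ : ℕ} (T : Tensor α n₁ n₂ n₃) :
    Matrix (Fin n₃ × Fin n₁) (Fin n₃ × Fin n₂) α :=
  fun p q => if p.1 = q.1 then T p.1 p.2 q.2 else 0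

/-- Conjugate transpose of a complex tensor: conjugate-transpose each slice and
reverse the order of slices `2,…,n₃` (i.e. slice `k ↦ -k` in 0-indexing). -/
def cConjT {n₁ n₂ n₃ : ℕ} (T : Tensor ℂ n₁ n₂ n₃) : Tensor ℂ n₂ n₁ n₃ :=
  fun k => (T (-k))ᴴ

/-- Conjugate transpose of a quaternion tensor, defined by
`unfold(A*) = unfold(A_d*) − (P_{n₃} ⊗ I_{n₂})·unfold(A_c*)·j`. -/
def tConjT {n₁ n₂ n₃ : ℕ} (A : Tensor Quat n₁ n₂ n₃) : Tensor Quat n₂ n₁ n₃ :=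
  foldT ((unfoldT (cConjT (Td A))).map c2q -
    rsmul jH (((Pmat n₃ ⊗ₖ (1 : Matrix (Fin n₂) (Fin n₂) ℂ)) *
      unfoldT (cConjT (Tc A))).map c2q))

/-- The identity tensor: identity matrix as first frontal slice, zero elsewhere. -/
def idT (n n₃ : ℕ) : Tensor Quat n n n₃ :=
  fun k => if (k : ℕ) = 0 then (1 : Matrix (Fin n) (Fin n) Quat) else 0

/-- A quaternion tensor is unitary if `U* *_Q U = U *_Q U* = I`. -/
def IsUnitaryT {n n₃ : ℕ} (U : Tensor Quat n n n₃) : Prop :=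
  qtmul (tConjT U) U = idT n n₃ ∧ qtmul U (tConjT U) = idT n n₃

/-- A quaternion tensor is Hermitian if `H* = H`. -/
def IsHermitianT {n n₃ : ℕ} (H : Tensor Quat n n n₃) : Prop := tConjT H = H

/-- A quaternion matrix `M` is positive semidefinite if `x*·M·x` is a nonnegative
real number for every quaternion vector `x`. -/
def IsPSDMat {m : Type*} [Fintype m] (M : Matrix m m Quat) : Prop :=
  ∀ x : m → Quat, ∃ r : ℝ, 0 ≤ r ∧ (star x) ⬝ᵥ M.mulVec x = (r : Quat)

@[simp] theorem re_c2q (z : ℂ) : (c2q z).re = z.re := rfl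
@[simp] theorem imI_c2q (z : ℂ) : (c2q z).imI = z.im := rfl
@[simp] theorem imJ_c2q (z : ℂ) : (c2q z).imJ = 0 := rfl
@[simp] theorem imK_c2q (z : ℂ) : (c2q z).imK = 0 := rfl
@[simp] theorem re_jH : jH.re = 0 := rfl
@[simp] theorem imI_jH : jH.imI = 0 := rfl
@[simp] theorem imJ_jH : jH.imJ = 1 := rfl
@[simp] theorem imK_jH : jH.imK = 0 := rfl

theorem Quaternion.re_mul_comm (p q : Quat) : (p * q).re = (q * p).re := by
  simp only [Quaternion.re_mul]; ring

theorem Quaternion.eq_coe_re_of_norm_le_re {q : Quat} (h : ‖q‖ ≤ q.re) : q = (q.re : Quat) := by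
  have h1 := Quaternion.normSq_eq_norm_mul_self q
  rw [Quaternion.normSq_def'] at h1
  have h2 : ‖q‖ * ‖q‖ ≤ q.re * q.re := mul_self_le_mul_self (norm_nonneg _) h
  have hi : q.imI = 0 := by nlinarith [sq_nonneg q.imI, sq_nonneg q.imJ, sq_nonneg q.imK]
  have hj : q.imJ = 0 := by nlinarith [sq_nonneg q.imI, sq_nonneg q.imJ, sq_nonneg q.imK]
  have hk : q.imK = 0 := by nlinarith [sq_nonneg q.imI, sq_nonneg q.imJ, sq_nonneg q.imK]
  ext <;> simp [hi, hj, hk]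

theorem Quaternion.exists_unit_mul_re_eq_norm (q : Quat) :
    ∃ u : Quat, star u * u = 1 ∧ u * star u = 1 ∧ (u * q).re = ‖q‖ := by
  by_cases hq : q = 0
  · exact ⟨1, by simp [hq]⟩
  have hn : ‖q‖ ≠ 0 := norm_ne_zero_iff.mpr hq
  have hnorm : Quaternion.normSq (‖q‖⁻¹ • star q) = 1 := by
    rw [Quaternion.normSq_smul, Quaternion.normSq_star, Quaternion.normSq_eq_norm_mul_self]
    field_simp
  refine ⟨‖q‖⁻¹ • star q, ?_, ?_, ?_⟩
  · rw [Quaternion.star_mul_self]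
    rw [hnorm, Quaternion.coe_one]
  · rw [Quaternion.self_mul_star]
    rw [hnorm, Quaternion.coe_one]
  · simp only [smul_mul_assoc, Quaternion.star_mul_self, Quaternion.normSq_eq_norm_mul_self,
      Quaternion.re_smul, Quaternion.re_coe, smul_eq_mul]
    field_simp

theorem dotProduct_star_self_eq_coe {m : Type*} [Fintype m] (x : m → Quat) :
    star x ⬝ᵥ x = ((∑ a, Quaternion.normSq (x a) : ℝ) : Quat) := by
  simp only [dotProduct, Pi.star_apply, Quaternion.star_mul_self]
  exact (map_sum (algebraMap ℝ Quat) _ _).symm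

theorem isCompact_unitary_quat {m : Type*} [Fintype m] [DecidableEq m] :
    IsCompact {U : Matrix m m Quat | U * Uᴴ = 1 ∧ Uᴴ * U = 1} := by
  have hK : IsCompact (Set.univ.pi fun _ : m => Set.univ.pi fun _ : m =>
      Metric.closedBall (0 : Quat) 1) :=
    isCompact_univ_pi fun _ => isCompact_univ_pi fun _ =>
      have := FiniteDimensional.proper_real Quat
      isCompact_closedBall _ _
  refine hK.of_isClosed_subset ?_ ?_
  · refine (isClosed_eq (X := Matrix m m Quat) ?_ continuous_const).inter
      (isClosed_eq (X := Matrix m m Quat) ?_ continuous_const)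
    · exact continuous_id.matrix_mul continuous_id.matrix_conjTranspose
    · exact continuous_id.matrix_conjTranspose.matrix_mul continuous_id
  · rintro U ⟨-, hU⟩ a - b -
    have h := congrFun (congrFun hU b) b
    have h2 := dotProduct_star_self_eq_coe (fun a => U a b)
    have h3 : (1 : ℝ) = ∑ a, Quaternion.normSq (U a b) := by
      rw [Matrix.one_apply_eq] at h
      have h4 := h.symm.trans h2
      exact Quaternion.coe_injective (Quaternion.coe_one.trans h4)
    have h4 : Quaternion.normSq (U a b) ≤ 1 := by
      rw [h3]
      exact Finset.single_le_sum (f := fun a => Quaternion.normSq (U a b))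
        (fun _ _ => Quaternion.normSq_nonneg) (Finset.mem_univ a)
    rw [Quaternion.normSq_eq_norm_mul_self] at h4
    rw [mem_closedBall_zero_iff]
    nlinarith [norm_nonneg (U a b)]

/-- The matrix `1 - x c x*`, a quaternion version of a complex reflection. -/
def reflectionMat {m : Type*} [DecidableEq m] (x : m → Quat) (c : Quat) : Matrix m m Quat :=
  1 - of fun a b => x a * c * star (x b)

theorem conjTranspose_reflectionMat {m : Type*} [DecidableEq m] (x : m → Quat) (c : Quat) :
    (reflectionMat x c)ᴴ = reflectionMat x (star c) := by
  ext1 a b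
  simp [reflectionMat, conjTranspose_apply, Matrix.one_apply, mul_assoc, eq_comm, apply_ite star]

theorem reflectionMat_mul {m : Type*} [Fintype m] [DecidableEq m] (x : m → Quat) (c d : Quat)
    (h : c + d = c * (star x ⬝ᵥ x) * d) : reflectionMat x c * reflectionMat x d = 1 := by
  have key : (of fun a b => x a * c * star (x b)) * (of fun a b => x a * d * star (x b)) =
      of fun a b => x a * (c + d) * star (x b) := by
    ext1 a b
    simp only [mul_apply, of_apply, h, dotProduct, Finset.mul_sum, Finset.sum_mul, Pi.star_apply,
      mul_assoc]
  rw [reflectionMat, reflectionMat, sub_mul, mul_sub, mul_sub, key, one_mul, mul_one, one_mul]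
  ext1 a b
  simp only [Matrix.sub_apply, of_apply, mul_add, add_mul]
  abel

theorem re_trace_reflectionMat_mul {m : Type*} [Fintype m] [DecidableEq m] (x : m → Quat) (c : Quat) (B : Matrix m m Quat) :
    (trace (reflectionMat x c * B)).re = (trace B).re - (c * (star x ⬝ᵥ B *ᵥ x)).re := by
  have hre (s : Finset m) (f : m → Quat) : (∑ a ∈ s, f a).re = ∑ a ∈ s, (f a).re :=
    map_sum (AddMonoidHom.mk' (fun q : Quat => q.re) fun _ _ => rfl) _ _
  rw [reflectionMat, sub_mul, one_mul, trace_sub, Quaternion.re_sub]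
  congr 1
  simp only [trace, diag_apply, mul_apply, of_apply, dotProduct, mulVec, Finset.mul_sum, hre,
    Pi.star_apply]
  rw [Finset.sum_comm]
  refine Finset.sum_congr rfl fun b _ => Finset.sum_congr rfl fun a _ => ?_
  rw [mul_assoc, mul_assoc, Quaternion.re_mul_comm]
  simp only [mul_assoc]

theorem IsPSDMat.conjTranspose_eq {m : Type*} [Fintype m] [DecidableEq m] {B : Matrix m m Quat} (hB : IsPSDMat B) : Bᴴ = B := by
  have hreal (x : m → Quat) : star x ⬝ᵥ (Bᴴ - B) *ᵥ x = 0 := by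
    obtain ⟨r, -, hr⟩ := hB x
    have h2 : star x ⬝ᵥ Bᴴ *ᵥ x = star (star x ⬝ᵥ B *ᵥ x) := by
      rw [star_dotProduct, star_mulVec, conjTranspose_conjTranspose, dotProduct_mulVec]
    rw [sub_mulVec, dotProduct_sub, h2, hr, Quaternion.star_coe, sub_self]
  have hsum (x y : m → Quat) : star x ⬝ᵥ (Bᴴ - B) *ᵥ y + star y ⬝ᵥ (Bᴴ - B) *ᵥ x = 0 := by
    have h := hreal (x + y)
    rw [star_add, mulVec_add, add_dotProduct, dotProduct_add, dotProduct_add, hreal x, hreal y,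
      zero_add, add_zero] at h
    exact h
  ext1 a b
  have hentry (r : Quat) : (star (B b a) - B a b) * r + star r * (star (B a b) - B b a) = 0 := by
    simpa [← Pi.single_star, mulVec_single, conjTranspose_apply] using
      hsum (Pi.single a 1) (Pi.single b r)
  have h1 := hentry 1
  have h2 := hentry jH
  have h3 := hentry (c2q Complex.I)
  rw [conjTranspose_apply]
  simp only [Quaternion.ext_iff] at h1 h2 h3 ⊢
  simp at h1 h2 h3 ⊢
  refine ⟨?_, ?_, ?_, ?_⟩ <;> linarith

/-- Polar decomposition of square quaternion matrices. The unitary factor maximizes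
`U ↦ Re (tr (Uᴴ * A))`. -/
theorem exists_polar_quat {m : Type*} [Fintype m] [DecidableEq m] (A : Matrix m m Quat) :
    ∃ U H : Matrix m m Quat, A = U * H ∧ (U * Uᴴ = 1 ∧ Uᴴ * U = 1) ∧ IsPSDMat H := by
  obtain ⟨U, ⟨hU1, hU2⟩, hmax⟩ := (isCompact_unitary_quat (m := m)).exists_isMaxOn
    ⟨1, by simp⟩ (f := fun U => (trace (Uᴴ * A)).re) (Continuous.continuousOn
      (Quaternion.continuous_re.comp
        (continuous_id.matrix_conjTranspose.matrix_mul continuous_const).matrix_trace))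
  refine ⟨U, Uᴴ * A, by rw [← mul_assoc, hU1, one_mul], ⟨hU1, hU2⟩, fun x => ?_⟩
  set q := star x ⬝ᵥ (Uᴴ * A) *ᵥ x with hq
  by_cases hx : x = 0
  · exact ⟨0, le_rfl, by simp [hq, hx]⟩
  obtain ⟨u, hu1, hu2, hu⟩ := Quaternion.exists_unit_mul_re_eq_norm q
  have hN := dotProduct_star_self_eq_coe x
  set N : ℝ := ∑ a, Quaternion.normSq (x a)
  have hN0 : 0 < N := by
    obtain ⟨a, ha⟩ := Function.ne_iff.mp hx
    refine Finset.sum_pos' (fun _ _ => Quaternion.normSq_nonneg) ⟨a, Finset.mem_univ a, ?_⟩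
    exact Quaternion.normSq_nonneg.lt_of_ne' (Quaternion.normSq_ne_zero.mpr ha)
  set c : Quat := N⁻¹ • (1 - u) with hc
  have hrel (v w : Quat) (h : v * w = 1) :
      N⁻¹ • (1 - v) + N⁻¹ • (1 - w) = N⁻¹ • (1 - v) * (star x ⬝ᵥ x) * N⁻¹ • (1 - w) := by
    rw [hN, ← Quaternion.coe_commutes, mul_assoc, Quaternion.coe_mul_eq_smul, smul_mul_smul_comm,
      smul_smul, ← smul_add]
    congr 1
    · field_simp
    · rw [sub_mul, mul_sub, mul_sub, h]; simp; abel
  have hcs : star c = N⁻¹ • (1 - star u) := by simp [hc]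
  have hV1 : reflectionMat x c * reflectionMat x (star c) = 1 :=
    reflectionMat_mul _ _ _ (by rw [hcs]; exact hrel _ _ hu2)
  have hV2 : reflectionMat x (star c) * reflectionMat x c = 1 :=
    reflectionMat_mul _ _ _ (by rw [hcs]; exact hrel _ _ hu1)
  have hle : (trace ((U * reflectionMat x (star c))ᴴ * A)).re ≤ (trace (Uᴴ * A)).re := by
    refine hmax ⟨?_, ?_⟩
    · rw [conjTranspose_mul, conjTranspose_reflectionMat, star_star, mul_assoc, ← mul_assoc _ _ Uᴴ,
        hV2, one_mul, hU1]
    · rw [conjTranspose_mul, conjTranspose_reflectionMat, star_star, mul_assoc, ← mul_assoc Uᴴ,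
        hU2, one_mul, hV1]
  rw [conjTranspose_mul, conjTranspose_reflectionMat, star_star, mul_assoc,
    re_trace_reflectionMat_mul, ← hq, hc, smul_mul_assoc, sub_mul, one_mul, Quaternion.re_smul,
    Quaternion.re_sub, hu, smul_eq_mul] at hle
  have hqre : ‖q‖ ≤ q.re := by
    have := (mul_nonneg_iff_of_pos_left (inv_pos.mpr hN0)).mp
      (show 0 ≤ N⁻¹ * (q.re - ‖q‖) by linarith)
    linarith
  exact ⟨q.re, (norm_nonneg _).trans hqre, Quaternion.eq_coe_re_of_norm_le_re hqre⟩

theorem c2q_mul (z w : ℂ) : c2q (z * w) = c2q z * c2q w := by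
  ext <;> simp

theorem c2q_add (z w : ℂ) : c2q (z + w) = c2q z + c2q w := by
  ext <;> simp

theorem c2q_zero : c2q 0 = 0 := by
  ext <;> rfl

theorem c2q_one : c2q 1 = 1 := by
  ext <;> rfl

theorem c2q_star (z : ℂ) : c2q (star z) = star (c2q z) := by
  ext <;> simp

/-- `c2q` as a ring homomorphism. -/
def c2qHom : ℂ →+* Quat where
  toFun := c2q
  map_one' := c2q_one
  map_mul' := c2q_mul
  map_zero' := c2q_zero
  map_add' := c2q_add

theorem c2q_sum {ι : Type*} (s : Finset ι) (f : ι → ℂ) :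
    c2q (∑ a ∈ s, f a) = ∑ a ∈ s, c2q (f a) :=
  map_sum c2qHom f s

theorem c2q_mul_jH (z : ℂ) : c2q z * jH = jH * c2q (star z) := by
  ext <;> simp

theorem c2q_qd_add_jH_mul_c2q_qc (q : Quat) : c2q (qd q) + jH * c2q (qc q) = q := by
  ext <;> simp [qd, qc]

theorem qd_c2q_add_jH_mul_c2q (z w : ℂ) : qd (c2q z + jH * c2q w) = z := by
  apply Complex.ext <;> simp [qd]

theorem qc_c2q_add_jH_mul_c2q (z w : ℂ) : qc (c2q z + jH * c2q w) = w := by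
  apply Complex.ext <;> simp [qc]

theorem c2q_mul_mul_c2q (x y : ℂ) (q : Quat) :
    c2q x * q * c2q y = c2q (x * y * qd q) + jH * c2q (star x * y * qc q) := by
  conv_lhs => rw [← c2q_qd_add_jH_mul_c2q_qc q]
  rw [mul_add, add_mul, ← mul_assoc (c2q x) jH, c2q_mul_jH, mul_assoc jH, mul_assoc jH,
    ← c2q_mul, ← c2q_mul, ← c2q_mul, ← c2q_mul, mul_right_comm, mul_right_comm (star x)]

theorem bcircz_apply {n₁ n₂ m : ℕ} (A : Tensor Quat n₁ n₂ (m + 1)) (p q : Fin (m + 1))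
    (s : Fin n₁) (t : Fin n₂) :
    bcircz A (p, s) (q, t) = c2q (qd (A (p - q) s t)) + jH * c2q (qc (A (p + q) s t)) := by
  have hP (k : Fin (m + 1)) : Pmat (m + 1) k q = if k = -q then 1 else 0 := by
    have h : ((k : ℕ) + (q : ℕ)) % (m + 1) = 0 ↔ k = -q := by
      rw [← Fin.val_add, Fin.val_eq_zero_iff, add_eq_zero_iff_eq_neg]
    simp only [Pmat, h]
  simp [bcircz, lsmul, bcirc, mul_apply, kroneckerMap_apply, Fintype.sum_prod_type, hP,
    Matrix.one_apply, Td, Tc]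

/-- `e p k` behaves like `exp (2πi p k / (m + 1))`. -/
structure IsFourierKernel {m : ℕ} (e : Fin (m + 1) → Fin (m + 1) → ℂ) : Prop where
  add (p q k : Fin (m + 1)) : e (p + q) k = e p k * e q k
  neg (p k : Fin (m + 1)) : e (-p) k = star (e p k)
  symm (p k : Fin (m + 1)) : e p k = e k p
  sum (p : Fin (m + 1)) : ∑ k, e p k = if p = 0 then ((m + 1 : ℝ) : ℂ) else 0

theorem exists_isFourierKernel (m : ℕ) :
    ∃ e : Fin (m + 1) → Fin (m + 1) → ℂ, IsFourierKernel e := by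
  suffices h : ∃ e : ZMod (m + 1) → ZMod (m + 1) → ℂ,
      (∀ p q k, e (p + q) k = e p k * e q k) ∧ (∀ p k, e (-p) k = star (e p k)) ∧
      (∀ p k, e p k = e k p) ∧
      ∀ p, ∑ k, e p k = if p = 0 then ((m + 1 : ℝ) : ℂ) else 0 by
    obtain ⟨e, h1, h2, h3, h4⟩ := h
    exact ⟨e, h1, h2, h3, h4⟩
  refine ⟨fun p k => ZMod.stdAddChar (k * p), fun p q k => ?_, fun p k => ?_, fun p k => ?_,
    fun p => ?_⟩
  · change ZMod.stdAddChar (k * (p + q)) = _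
    rw [mul_add, AddChar.map_add_eq_mul]
  · change ZMod.stdAddChar (k * -p) = _
    rw [mul_neg, AddChar.map_neg_eq_conj]
    rfl
  · exact congrArg _ (mul_comm k p)
  · rw [AddChar.sum_mulShift p (ZMod.isPrimitive_stdAddChar (m + 1)), ZMod.card]
    push_cast
    rfl

namespace IsFourierKernel

variable {m : ℕ} {e : Fin (m + 1) → Fin (m + 1) → ℂ}

theorem sub (he : IsFourierKernel e) (p q k : Fin (m + 1)) :
    e (p - q) k = e p k * star (e q k) := by
  rw [sub_eq_add_neg, he.add, he.neg]

theorem sum_mul_star (he : IsFourierKernel e) (p q : Fin (m + 1)) :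
    ∑ k, e p k * star (e q k) = if p = q then ((m + 1 : ℝ) : ℂ) else 0 := by
  simp_rw [← he.sub, he.sum, sub_eq_zero]

end IsFourierKernel

/-- The normalized quaternion Fourier matrix with kernel `e`, acting blockwise. -/
def fourierMat {m : ℕ} (e : Fin (m + 1) → Fin (m + 1) → ℂ) (n : ℕ) :
    Matrix (Fin (m + 1) × Fin n) (Fin n × Fin (m + 1)) Quat :=
  of fun p k => if p.2 = k.1 then c2q (((√(m + 1 : ℝ))⁻¹ : ℝ) * e p.1 k.2) else 0

/-- The tensor whose z-block circulant matrix is block diagonalized to `D` by `fourierMat`. -/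
def fourierTensor {m n₁ n₂ : ℕ} (e : Fin (m + 1) → Fin (m + 1) → ℂ)
    (D : Tensor Quat n₁ n₂ (m + 1)) : Tensor Quat n₁ n₂ (m + 1) :=
  fun r s t => c2q (((m + 1 : ℝ) : ℂ)⁻¹ * ∑ k, e r k * qd (D k s t)) +
    jH * c2q (((m + 1 : ℝ) : ℂ)⁻¹ * ∑ k, star (e r k) * qc (D k s t))

namespace IsFourierKernel

variable {m : ℕ} {e : Fin (m + 1) → Fin (m + 1) → ℂ}

theorem inv_sqrt_mul_inv_sqrt (m : ℕ) :
    (((√(m + 1 : ℝ))⁻¹ : ℝ) : ℂ) * (((√(m + 1 : ℝ))⁻¹ : ℝ) : ℂ) = ((m + 1 : ℝ) : ℂ)⁻¹ := by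
  rw [← Complex.ofReal_mul, ← mul_inv, Real.mul_self_sqrt (by positivity), Complex.ofReal_inv]

theorem normalized_mul (m : ℕ) (x y : ℂ) :
    ((((√(m + 1 : ℝ))⁻¹ : ℝ) : ℂ) * x) * star ((((√(m + 1 : ℝ))⁻¹ : ℝ) : ℂ) * y) =
      ((m + 1 : ℝ) : ℂ)⁻¹ * (x * star y) := by
  rw [star_mul', Complex.star_def, Complex.conj_ofReal, mul_mul_mul_comm, inv_sqrt_mul_inv_sqrt]

theorem star_normalized_mul (m : ℕ) (x y : ℂ) :
    star ((((√(m + 1 : ℝ))⁻¹ : ℝ) : ℂ) * x) * star ((((√(m + 1 : ℝ))⁻¹ : ℝ) : ℂ) * y) =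
      ((m + 1 : ℝ) : ℂ)⁻¹ * (star x * star y) := by
  rw [star_mul', star_mul', Complex.star_def, Complex.conj_ofReal, mul_mul_mul_comm,
    inv_sqrt_mul_inv_sqrt]

theorem sum_normalized (he : IsFourierKernel e) (p q : Fin (m + 1)) :
    ∑ k, (((√(m + 1 : ℝ))⁻¹ : ℝ) * e p k) * star ((((√(m + 1 : ℝ))⁻¹ : ℝ) : ℂ) * e q k) =
      if p = q then 1 else 0 := by
  have hm : ((m + 1 : ℝ) : ℂ) ≠ 0 := by exact_mod_cast m.succ_ne_zero
  simp_rw [normalized_mul, ← Finset.mul_sum, he.sum_mul_star, mul_ite,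
    inv_mul_cancel₀ hm, mul_zero]

theorem fourierMat_mul_conjTranspose (he : IsFourierKernel e) (n : ℕ) :
    fourierMat e n * (fourierMat e n)ᴴ = 1 := by
  ext1 ⟨p, s⟩ ⟨q, t⟩
  simp only [fourierMat, mul_apply, conjTranspose_apply, of_apply, Fintype.sum_prod_type,
    apply_ite star, star_zero, ← c2q_star, ite_mul, mul_ite, zero_mul, mul_zero, ← c2q_mul]
  rw [Finset.sum_comm]
  simp only [Finset.sum_ite_eq, Finset.mem_univ, if_true]
  by_cases hst : t = s
  · simp only [hst, if_true, ← c2q_sum, he.sum_normalized, Matrix.one_apply, Prod.mk.injEq,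
      and_true]
    split_ifs
    exacts [c2q_one, c2q_zero]
  · simp [Ne.symm hst]

theorem conjTranspose_mul_fourierMat (he : IsFourierKernel e) (n : ℕ) :
    (fourierMat e n)ᴴ * fourierMat e n = 1 := by
  ext1 ⟨s, p⟩ ⟨t, q⟩
  simp only [fourierMat, mul_apply, conjTranspose_apply, of_apply, Fintype.sum_prod_type,
    apply_ite star, star_zero, ← c2q_star, ite_mul, mul_ite, zero_mul, mul_zero, ← c2q_mul]
  simp only [Finset.sum_ite_eq', Finset.mem_univ, if_true]
  by_cases hst : s = t
  · simp only [hst, if_true, ← c2q_sum, Matrix.one_apply, Prod.mk.injEq, true_and]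
    simp_rw [he.symm _ p, he.symm _ q, mul_comm (star _), he.sum_normalized, eq_comm (a := q)]
    split_ifs
    exacts [c2q_one, c2q_zero]
  · simp [hst, Ne.symm hst]

theorem bcircz_fourierTensor (he : IsFourierKernel e) {n₁ n₂ : ℕ}
    (D : Tensor Quat n₁ n₂ (m + 1)) :
    bcircz (fourierTensor e D) = fourierMat e n₁ * blockDiagonal D * (fourierMat e n₂)ᴴ := by
  ext1 ⟨p, s⟩ ⟨q, t⟩
  have hentry : (fourierMat e n₁ * blockDiagonal D * (fourierMat e n₂)ᴴ) (p, s) (q, t) =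
      ∑ k, c2q (((√(m + 1 : ℝ))⁻¹ : ℝ) * e p k) * D k s t *
        c2q (star ((((√(m + 1 : ℝ))⁻¹ : ℝ) : ℂ) * e q k)) := by
    simp only [fourierMat, mul_apply, conjTranspose_apply, of_apply, Fintype.sum_prod_type,
      apply_ite star, star_zero, ← c2q_star, blockDiagonal_apply, ite_mul, mul_ite, zero_mul,
      mul_zero, Finset.sum_ite_eq', Finset.mem_univ, if_true]
    rw [Finset.sum_comm]
    simp only [Finset.sum_ite_eq, Finset.mem_univ, if_true]
  rw [hentry, bcircz_apply, fourierTensor, fourierTensor, qd_c2q_add_jH_mul_c2q,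
    qc_c2q_add_jH_mul_c2q]
  simp_rw [c2q_mul_mul_c2q]
  rw [Finset.sum_add_distrib, ← Finset.mul_sum, ← c2q_sum, ← c2q_sum, Finset.mul_sum,
    Finset.mul_sum]
  simp_rw [normalized_mul, star_normalized_mul, he.sub, he.add, star_mul', mul_assoc]

theorem fourierTensor_surjective (he : IsFourierKernel e) {n₁ n₂ : ℕ} :
    Function.Surjective (fourierTensor e : Tensor Quat n₁ n₂ (m + 1) → _) := by
  intro A
  have hm : ((m + 1 : ℝ) : ℂ) ≠ 0 := by exact_mod_cast m.succ_ne_zero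
  have hinv (a : Fin (m + 1) → ℂ) (r : Fin (m + 1)) :
      ((m + 1 : ℝ) : ℂ)⁻¹ * ∑ k, e r k * ∑ r', star (e r' k) * a r' = a r := by
    have hk (k : Fin (m + 1)) : e r k * ∑ r', star (e r' k) * a r' =
        ∑ r', e r k * (star (e r' k) * a r') := Finset.mul_sum ..
    simp_rw [hk]
    rw [Finset.sum_comm]
    simp_rw [← mul_assoc, ← Finset.sum_mul, he.sum_mul_star, ite_mul, zero_mul]
    rw [Finset.sum_ite_eq, if_pos (Finset.mem_univ _), inv_mul_cancel_left₀ hm]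
  have hinv' (a : Fin (m + 1) → ℂ) (r : Fin (m + 1)) :
      ((m + 1 : ℝ) : ℂ)⁻¹ * ∑ k, star (e r k) * ∑ r', e r' k * a r' = a r := by
    have h := congrArg star (hinv (fun r => star (a r)) r)
    simpa [-Complex.ofReal_add] using h
  refine ⟨fun k s t => c2q (∑ r, star (e r k) * qd (A r s t)) +
    jH * c2q (∑ r, e r k * qc (A r s t)), ?_⟩
  funext r s t
  simp only [fourierTensor, qd_c2q_add_jH_mul_c2q, qc_c2q_add_jH_mul_c2q]
  rw [hinv (fun r => qd (A r s t)), hinv' (fun r => qc (A r s t)), c2q_qd_add_jH_mul_c2q_qc]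

end IsFourierKernel

theorem IsPSDMat.blockDiagonal {m o : Type*} [Fintype m] [Fintype o] [DecidableEq o]
    {D : o → Matrix m m Quat} (hD : ∀ k, IsPSDMat (D k)) : IsPSDMat (blockDiagonal D) := by
  intro x
  choose r hr0 hr using fun k => hD k fun s => x (s, k)
  refine ⟨∑ k, r k, Finset.sum_nonneg fun k _ => hr0 k, ?_⟩
  have hcoe : ((∑ k, r k : ℝ) : Quat) = ∑ k, (r k : Quat) := map_sum (algebraMap ℝ Quat) _ _
  simp_rw [hcoe, ← hr]
  simp only [dotProduct, mulVec, blockDiagonal_apply, Fintype.sum_prod_type, ite_mul, zero_mul,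
    Finset.sum_ite_eq, Finset.mem_univ, if_true, Pi.star_apply]
  exact Finset.sum_comm

theorem IsPSDMat.mul_mul_conjTranspose {m l : Type*} [Fintype m] [Fintype l]
    {B : Matrix m m Quat} (hB : IsPSDMat B) (W : Matrix l m Quat) : IsPSDMat (W * B * Wᴴ) := by
  intro x
  obtain ⟨r, hr0, hr⟩ := hB (Wᴴ *ᵥ x)
  refine ⟨r, hr0, ?_⟩
  rw [← hr, star_mulVec, conjTranspose_conjTranspose, ← mulVec_mulVec, ← mulVec_mulVec,
    dotProduct_mulVec]

/-- there exist tensors `U, H` with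
`bcirc_z(A) = bcirc_z(U)·bcirc_z(H)`, `bcirc_z(U)` unitary, and `bcirc_z(H)`
Hermitian positive semidefinite. -/
theorem stmt6 {n n₃ : ℕ} (A : Tensor Quat n n n₃) :
    ∃ U H : Tensor Quat n n n₃,
      bcircz A = bcircz U * bcircz H ∧
      (bcircz U * (bcircz U)ᴴ = 1 ∧ (bcircz U)ᴴ * bcircz U = 1) ∧
      (bcircz H)ᴴ = bcircz H ∧ IsPSDMat (bcircz H) := by
  obtain _ | m := n₃
  · exact ⟨A, A, Subsingleton.elim _ _, ⟨Subsingleton.elim _ _, Subsingleton.elim _ _⟩,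
      Subsingleton.elim _ _, fun x => ⟨0, le_rfl, by simp [dotProduct]⟩⟩
  obtain ⟨e, he⟩ := exists_isFourierKernel m
  obtain ⟨D, rfl⟩ := he.fourierTensor_surjective A
  choose U H hD hU hH using fun k => exists_polar_quat (D k)
  have hW := he.fourierMat_mul_conjTranspose n
  have hW' := he.conjTranspose_mul_fourierMat n
  have hmul (X Y : Matrix (Fin n × Fin (m + 1)) (Fin n × Fin (m + 1)) Quat) :
      fourierMat e n * X * (fourierMat e n)ᴴ * (fourierMat e n * Y * (fourierMat e n)ᴴ) =
        fourierMat e n * (X * Y) * (fourierMat e n)ᴴ := by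
    simp only [Matrix.mul_assoc]
    rw [← Matrix.mul_assoc (fourierMat e n)ᴴ (fourierMat e n), hW', Matrix.one_mul]
  have hstar (X : Matrix (Fin n × Fin (m + 1)) (Fin n × Fin (m + 1)) Quat) :
      (fourierMat e n * X * (fourierMat e n)ᴴ)ᴴ = fourierMat e n * Xᴴ * (fourierMat e n)ᴴ := by
    simp only [conjTranspose_mul, conjTranspose_conjTranspose, Matrix.mul_assoc]
  have hpsd : IsPSDMat (bcircz (fourierTensor e H)) := by
    rw [he.bcircz_fourierTensor]
    exact (IsPSDMat.blockDiagonal hH).mul_mul_conjTranspose _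
  refine ⟨fourierTensor e U, fourierTensor e H, ?_, ?_, hpsd.conjTranspose_eq, hpsd⟩
  · simp only [he.bcircz_fourierTensor]
    rw [hmul, ← blockDiagonal_mul, funext hD]
  · rw [he.bcircz_fourierTensor, hstar, hmul, hmul, blockDiagonal_conjTranspose,
      ← blockDiagonal_mul, ← blockDiagonal_mul, funext fun k => (hU k).1,
      funext fun k => (hU k).2]
    have h1 : blockDiagonal (fun _ : Fin (m + 1) => (1 : Matrix (Fin n) (Fin n) Quat)) = 1 :=
      blockDiagonal_one
    rw [h1, Matrix.mul_one, hW]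
    exact ⟨rfl, rfl⟩

end
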